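/- arXiv:1903.02033 — 2 statements merged into one kernel-verified Lean document; each statement's English description precedes it below -/
import Mathlib

section
/- The codimension order co(G(4,2,2)) is a ranked poset with three ranks of sizes 1, 8, and 7, and it has two maximal elements of rank 1; consequently the 7 elements of rank 2 together with these two elements form an antichain of size 9, which exceeds every rank size, and therefore co(G(4,2,2)) is not Sperner. -/
open Module Set

noncomputable section

variable {V : Type*} [AddCommGroup V] [Module ℂ V]

/-- The codimension of the fixed subspace of a linear automorphism. -/
def fixCodim (w : V ≃ₗ[ℂ] V) : ℕ :=
  finrank ℂ V - finrank ℂ (LinearMap.ker ((w : V →ₗ[ℂ] V) - 1))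

/-- A reflection: fixed space has codimension one. -/
def IsReflection (w : V ≃ₗ[ℂ] V) : Prop := fixCodim w = 1

/-- A finite subgroup of GL(V) generated by its reflections. -/
def IsComplexReflectionGroup (W : Set (V ≃ₗ[ℂ] V)) : Prop :=
  W.Finite ∧ W = (Subgroup.closure {t | t ∈ W ∧ IsReflection t} : Subgroup (V ≃ₗ[ℂ] V))

/-- Reflection length with respect to the reflections of `W`. -/
def reflLen (W : Set (V ≃ₗ[ℂ] V)) (w : V ≃ₗ[ℂ] V) : ℕ :=
  sInf {k | ∃ l : List (V ≃ₗ[ℂ] V), l.length = k ∧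
    (∀ t ∈ l, t ∈ W ∧ IsReflection t) ∧ l.prod = w}

/-- The prefix order relation. -/
def preLe (W : Set (V ≃ₗ[ℂ] V)) (u v : V ≃ₗ[ℂ] V) : Prop :=
  reflLen W u + reflLen W (u⁻¹ * v) = reflLen W v

/-- The codimension order relation. -/
def coLe (u v : V ≃ₗ[ℂ] V) : Prop :=
  fixCodim u + fixCodim (u⁻¹ * v) = fixCodim v

/-- The group `G(m,p,n)` of monomial matrices with `m`-th root of unity entries whose
product is an `(m/p)`-th root of unity, as linear automorphisms of `ℂⁿ`. -/
def Gmpn (m p n : ℕ) : Set ((Fin n → ℂ) ≃ₗ[ℂ] (Fin n → ℂ)) :=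
  {w | ∃ (σ : Equiv.Perm (Fin n)) (a : Fin n → ℂ),
    (∀ i, a i ^ m = 1) ∧ (∏ i, a i) ^ (m / p) = 1 ∧
    ∀ j, w (Pi.single j (1 : ℂ)) = a j • (Pi.single (σ j) (1 : ℂ) : Fin n → ℂ)}

section Poset

variable {α : Type*}

/-- An antichain of the poset on carrier `P` with order relation `le`. -/
def IsAntichainOn (P : Set α) (le : α → α → Prop) (A : Set α) : Prop :=
  A ⊆ P ∧ ∀ x ∈ A, ∀ y ∈ A, x ≠ y → ¬ le x y ∧ ¬ le y x

/-- `k`-Sperner: no union of `k` antichains is larger than the union of some `k` ranks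
(equivalently, of the `k` largest ranks). -/
def IsKSpernerOn (P : Set α) (le : α → α → Prop) (rk : α → ℕ) (k : ℕ) : Prop :=
  ∀ 𝒜 : Fin k → Set α, (∀ i, IsAntichainOn P le (𝒜 i)) →
    ∃ S : Finset ℕ, S.card ≤ k ∧ (⋃ i, 𝒜 i).ncard ≤ {x | x ∈ P ∧ rk x ∈ S}.ncard

def IsStronglySpernerOn (P : Set α) (le : α → α → Prop) (rk : α → ℕ) : Prop :=
  ∀ k, IsKSpernerOn P le rk k

/-- Sperner: no antichain is larger than some (equivalently, the largest) rank. -/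
def IsSpernerOn (P : Set α) (le : α → α → Prop) (rk : α → ℕ) : Prop :=
  ∀ A : Set α, IsAntichainOn P le A → ∃ i, A.ncard ≤ {x | x ∈ P ∧ rk x = i}.ncard

/-- Covering relation of the poset on carrier `P`. -/
def CoversOn (P : Set α) (le : α → α → Prop) (x y : α) : Prop :=
  x ∈ P ∧ y ∈ P ∧ le x y ∧ x ≠ y ∧ ∀ z ∈ P, le x z → le z y → z = x ∨ z = y

/-- A normalized flow on the bipartite graph with parts `A`, `B`, edge relation `E`
and vertex weights `ν`. -/
def IsNormalizedFlowBetween (A B : Set α) (E : α → α → Prop) (ν : α → ℝ)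
    (f : α → α → ℝ) : Prop :=
  (∀ a b, 0 ≤ f a b) ∧
  (∀ a b, f a b ≠ 0 → a ∈ A ∧ b ∈ B ∧ E a b) ∧
  (∀ a ∈ A, (∑ᶠ b ∈ B, f a b) = ν a / ∑ᶠ x ∈ A, ν x) ∧
  (∀ b ∈ B, (∑ᶠ a ∈ A, f a b) = ν b / ∑ᶠ x ∈ B, ν x)

/-- A ranked poset has a normalized flow if each bipartite graph of covering relations
between consecutive ranks admits one. -/
def HasNormalizedFlowOn (P : Set α) (le : α → α → Prop) (rk : α → ℕ) (ν : α → ℝ) : Prop :=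
  ∀ i : ℕ, ∃ f, IsNormalizedFlowBetween {x | x ∈ P ∧ rk x = i} {x | x ∈ P ∧ rk x = i + 1}
    (CoversOn P le) ν f

end Poset


lemma fixCodim_one : fixCodim (1 : (Fin 2 → ℂ) ≃ₗ[ℂ] (Fin 2 → ℂ)) = 0 := by
  have : ((1 : (Fin 2 → ℂ) ≃ₗ[ℂ] (Fin 2 → ℂ)) : (Fin 2 → ℂ) →ₗ[ℂ] (Fin 2 → ℂ)) - 1 = 0 :=
    sub_self _
  rw [fixCodim, this, LinearMap.ker_zero, finrank_top, Nat.sub_self]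

lemma fixCodim_eq_two {w : (Fin 2 → ℂ) ≃ₗ[ℂ] (Fin 2 → ℂ)} (h : ∀ x, w x = x → x = 0) :
    fixCodim w = 2 := by
  have : LinearMap.ker ((w : (Fin 2 → ℂ) →ₗ[ℂ] (Fin 2 → ℂ)) - 1) = ⊥ := by
    rw [LinearMap.ker_eq_bot']
    intro x hx
    exact h x (sub_eq_zero.1 hx)
  rw [fixCodim, this]
  simp

lemma fixCodim_eq_one {w : (Fin 2 → ℂ) ≃ₗ[ℂ] (Fin 2 → ℂ)} {u v : Fin 2 → ℂ} (hu : w u ≠ u)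
    (hv : v ≠ 0) (hw : w v = v) : fixCodim w = 1 := by
  set K := LinearMap.ker ((w : (Fin 2 → ℂ) →ₗ[ℂ] (Fin 2 → ℂ)) - 1) with hK
  have hpos : 0 < finrank ℂ K := by
    refine finrank_pos_iff_exists_ne_zero.2 ⟨⟨v, ?_⟩, fun h => hv (congrArg Subtype.val h)⟩
    exact sub_eq_zero.2 hw
  have hlt : finrank ℂ K < finrank ℂ (Fin 2 → ℂ) := by
    refine Submodule.finrank_lt fun h => hu (sub_eq_zero.1 ?_)
    have : u ∈ K := h ▸ Submodule.mem_top
    exact this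
  have h2 : finrank ℂ (Fin 2 → ℂ) = 2 := by simp
  rw [fixCodim, ← hK]
  omega

/-- The additive character `k ↦ I ^ k` of `ZMod 4`. -/
def iChar : AddChar (ZMod 4) ℂ := AddChar.zmodChar 4 Complex.I_pow_four

lemma iChar_apply (k : ZMod 4) : iChar k = Complex.I ^ k.val :=
  AddChar.zmodChar_apply Complex.I_pow_four k

lemma iChar_ne_zero (k : ZMod 4) : iChar k ≠ 0 := (iChar.val_isUnit k).ne_zero

lemma iChar_eq_one_iff {k : ZMod 4} : iChar k = 1 ↔ k = 0 := by
  refine ⟨fun h => ?_, fun h => h ▸ iChar.map_zero_eq_one⟩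
  have hd := (Complex.isPrimitiveRoot_I).dvd_of_pow_eq_one k.val (iChar_apply k ▸ h)
  have := Nat.eq_zero_of_dvd_of_lt hd (ZMod.val_lt k)
  exact (ZMod.val_eq_zero k).1 this

lemma iChar_injective : Function.Injective iChar := by
  intro k l h
  have : iChar (k - l) = 1 := by
    rw [AddChar.map_sub_eq_div, h, div_self (iChar_ne_zero l)]
  exact sub_eq_zero.1 (iChar_eq_one_iff.1 this)

lemma exists_iChar_eq {a : ℂ} (h : a ^ 4 = 1) : ∃ k, iChar k = a := by
  obtain ⟨i, hi, rfl⟩ := (Complex.isPrimitiveRoot_I).eq_pow_of_pow_eq_one h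
  exact ⟨(i : ZMod 4), by rw [iChar_apply, ZMod.val_natCast, Nat.mod_eq_of_lt hi]⟩

/-- Exponent data `(s, a)` of a monomial matrix whose entries are powers of `I`. -/
abbrev Code := Fin 2 × (Fin 2 → ZMod 4)

/-- The monomial automorphism sending `e j` to `I ^ a j • e (j + s)`. -/
def monomialEquiv (c : Code) : (Fin 2 → ℂ) ≃ₗ[ℂ] (Fin 2 → ℂ) where
  toFun x i := iChar (c.2 (i - c.1)) * x (i - c.1)
  invFun x j := iChar (-c.2 j) * x (j + c.1)
  map_add' x y := by ext i; simp [mul_add]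
  map_smul' r x := by ext i; simp [mul_left_comm]
  left_inv x := by
    ext j
    simp [← mul_assoc, ← AddChar.map_add_eq_mul]
  right_inv x := by
    ext j
    simp [← mul_assoc, ← AddChar.map_add_eq_mul]

lemma monomialEquiv_apply (c : Code) (x : Fin 2 → ℂ) (i : Fin 2) :
    monomialEquiv c x i = iChar (c.2 (i - c.1)) * x (i - c.1) := rfl

lemma monomialEquiv_single (c : Code) (j : Fin 2) :
    monomialEquiv c (Pi.single j 1) = iChar (c.2 j) • Pi.single (j + c.1) 1 := by
  ext i
  rw [monomialEquiv_apply]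
  by_cases h : i = j + c.1
  · subst h; simp
  · have : i - c.1 ≠ j := fun h' => h (by rw [← h', sub_add_cancel])
    simp [h, this]

lemma monomialEquiv_injective : Function.Injective monomialEquiv := by
  intro c d h
  have key : ∀ j, iChar (c.2 j) • (Pi.single (j + c.1) 1 : Fin 2 → ℂ) =
      iChar (d.2 j) • Pi.single (j + d.1) 1 := fun j => by
    rw [← monomialEquiv_single, ← monomialEquiv_single, h]
  have hs : c.1 = d.1 := by
    by_contra hne
    have := congrFun (key 0) c.1
    simp [hne, iChar_ne_zero] at this
  refine Prod.ext hs (funext fun j => iChar_injective ?_)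
  have := congrFun (key j) (j + c.1)
  simpa [hs] using this

/-- The code of `u⁻¹ * v` in terms of those of `u` and `v`. -/
def codeQuot (c d : Code) : Code :=
  (d.1 - c.1, fun j => d.2 j - c.2 (j + (d.1 - c.1)))

lemma inv_mul_monomialEquiv (c d : Code) :
    (monomialEquiv c)⁻¹ * monomialEquiv d = monomialEquiv (codeQuot c d) := by
  rw [inv_mul_eq_iff_eq_mul]
  ext x i
  change _ = monomialEquiv c (monomialEquiv (codeQuot c d) x) i
  simp only [monomialEquiv_apply, codeQuot, ← mul_assoc, ← AddChar.map_add_eq_mul]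
  have h : i - c.1 - (d.1 - c.1) = i - d.1 := by abel
  rw [h]
  have h' : i - d.1 + (d.1 - c.1) = i - c.1 := by abel
  rw [h', add_sub_cancel]

/-- The fixed space codimension of the automorphism with a given code. -/
def codeCodim (c : Code) : ℕ :=
  if c.1 = 0 then (if c.2 0 = 0 then 0 else 1) + (if c.2 1 = 0 then 0 else 1)
  else if c.2 0 + c.2 1 = 0 then 1 else 2

lemma fixCodim_monomialEquiv (c : Code) : fixCodim (monomialEquiv c) = codeCodim c := by
  obtain ⟨s, a⟩ := c
  obtain rfl | rfl : s = 0 ∨ s = 1 := by omega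
  · have happ : ∀ x i, monomialEquiv (0, a) x i = iChar (a i) * x i := fun x i => by
      simp [monomialEquiv_apply]
    have hfix : ∀ i, a i ≠ 0 → ∀ x, monomialEquiv (0, a) x = x → x i = 0 := fun i hi x hx =>
      (mul_left_eq_self₀.1 (happ x i ▸ congrFun hx i)).resolve_left (mt iChar_eq_one_iff.1 hi)
    by_cases h0 : a 0 = 0 <;> by_cases h1 : a 1 = 0
    · have : monomialEquiv (0, a) = 1 := by
        ext x i
        revert i
        simp [happ, h0, h1, Fin.forall_fin_two]
      simp [codeCodim, h0, h1, this, fixCodim_one]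
    · rw [fixCodim_eq_one (u := Pi.single 1 1) (v := Pi.single 0 1)]
      · simp [codeCodim, h0, h1]
      · exact fun h => by simpa using hfix 1 h1 _ h
      · simp
      · simp [monomialEquiv_single, h0]
    · rw [fixCodim_eq_one (u := Pi.single 0 1) (v := Pi.single 1 1)]
      · simp [codeCodim, h0, h1]
      · exact fun h => by simpa using hfix 0 h0 _ h
      · simp
      · simp [monomialEquiv_single, h1]
    · rw [fixCodim_eq_two]
      · simp [codeCodim, h0, h1]
      · intro x hx
        ext i
        revert i
        simp [hfix 0 h0 x hx, hfix 1 h1 x hx, Fin.forall_fin_two]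
  · have happ0 : ∀ x, monomialEquiv (1, a) x 0 = iChar (a 1) * x 1 := fun x => rfl
    have happ1 : ∀ x, monomialEquiv (1, a) x 1 = iChar (a 0) * x 0 := fun x => rfl
    by_cases h : a 0 + a 1 = 0
    · rw [fixCodim_eq_one (u := Pi.single 0 1) (v := ![1, iChar (a 0)])]
      · simp [codeCodim, h]
      · intro hu
        simpa [happ0] using congrFun hu 0
      · exact fun hv => by simpa using congrFun hv 0
      · ext i
        revert i
        simp [happ0, happ1, Fin.forall_fin_two, ← AddChar.map_add_eq_mul, add_comm (a 1), h]
    · rw [fixCodim_eq_two]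
      · simp [codeCodim, h]
      · intro x hx
        have e0 := happ0 x ▸ congrFun hx 0
        have e1 := happ1 x ▸ congrFun hx 1
        have hne : iChar (a 0) * iChar (a 1) ≠ 1 := by
          rwa [← AddChar.map_add_eq_mul, Ne, iChar_eq_one_iff]
        have x0 : x 0 = 0 := by
          have : (iChar (a 0) * iChar (a 1) - 1) * x 0 = 0 := by
            linear_combination e0 + iChar (a 1) * e1
          exact (mul_eq_zero.1 this).resolve_left (sub_ne_zero.2 hne)
        have x1 : x 1 = 0 := by rw [← e1, x0, mul_zero]
        ext i
        revert i
        simp [x0, x1, Fin.forall_fin_two]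

/-- The codes of the elements of `G(4,2,2)`. -/
def codes : Finset Code := {c | 2 * (c.2 0 + c.2 1) = 0}

lemma Gmpn_four_two_two : Gmpn 4 2 2 = monomialEquiv '' codes := by
  ext w
  have hpow : ∀ k l : ZMod 4, (iChar k * iChar l) ^ 2 = 1 ↔ 2 * (k + l) = 0 := fun k l => by
    rw [← AddChar.map_add_eq_mul, ← AddChar.map_nsmul_eq_pow, iChar_eq_one_iff, nsmul_eq_mul]
    rfl
  constructor
  · rintro ⟨σ, a, ha, hprod, hw⟩
    choose k hk using fun i => exists_iChar_eq (ha i)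
    have hσ : ∀ j, σ j = j + σ 0 := by
      have : ∀ σ : Equiv.Perm (Fin 2), ∀ j, σ j = j + σ 0 := by decide
      exact this σ
    refine ⟨(σ 0, k), ?_, ?_⟩
    · rw [Fin.prod_univ_two, ← hk, ← hk] at hprod
      simpa [codes] using (hpow _ _).1 hprod
    · refine LinearEquiv.toLinearMap_injective (LinearMap.pi_ext' fun j => LinearMap.ext_ring ?_)
      change monomialEquiv _ (Pi.single j 1) = w (Pi.single j 1)
      rw [hw, monomialEquiv_single, hk, hσ j]
  · rintro ⟨c, hc, rfl⟩
    refine ⟨Equiv.addRight c.1, fun j => iChar (c.2 j), fun i => ?_, ?_, monomialEquiv_single c⟩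
    · rw [← AddChar.map_nsmul_eq_pow, iChar_eq_one_iff]
      generalize c.2 i = k
      revert k
      decide
    · rw [Fin.prod_univ_two]
      exact (hpow _ _).2 (by simpa [codes] using hc)

/-- The codimension order on codes. -/
def codeLe (c d : Code) : Prop := codeCodim c + codeCodim (codeQuot c d) = codeCodim d

instance (c d : Code) : Decidable (codeLe c d) := inferInstanceAs (Decidable (_ = _))

lemma coLe_monomialEquiv (c d : Code) :
    coLe (monomialEquiv c) (monomialEquiv d) ↔ codeLe c d := by
  rw [coLe, codeLe, inv_mul_monomialEquiv, fixCodim_monomialEquiv, fixCodim_monomialEquiv,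
    fixCodim_monomialEquiv]

/-- The code of the scalar `I ^ k`. -/
def scalarCode (k : ZMod 4) : Code := (0, fun _ => k)

/-- The rank in the codimension order, on codes. -/
def codeRank (c : Code) : ℕ :=
  if c = scalarCode 1 ∨ c = scalarCode 3 then 1 else codeCodim c

lemma codeRank_eq_of_covers : ∀ c ∈ codes, ∀ d ∈ codes, codeLe c d → c ≠ d →
    codeRank d = codeRank c + 1 ∨
      ∃ t ∈ codes, codeLe c t ∧ codeLe t d ∧ t ≠ c ∧ t ≠ d := by
  decide +kernel

/-- The set of codes of rank `i`. -/
def codesOfRank (i : ℕ) : Finset Code := {c ∈ codes | codeRank c = i}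

/-- The rank-two codes together with the two scalars of order four. -/
def codeAntichain : Finset Code := codesOfRank 2 ∪ {scalarCode 1, scalarCode 3}

lemma codeAntichain_subset : codeAntichain ⊆ codes := by decide +kernel

lemma not_codeLe_of_mem_codeAntichain :
    ∀ c ∈ codeAntichain, ∀ d ∈ codeAntichain, c ≠ d → ¬ codeLe c d := by
  decide +kernel

lemma card_codeAntichain : codeAntichain.card = 9 := by decide +kernel

lemma scalarCode_maximal :
    ∀ k : ZMod 4, k = 1 ∨ k = 3 → ∀ d ∈ codes, codeLe (scalarCode k) d → d = scalarCode k := by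
  decide +kernel

lemma codeRank_le_two : ∀ c ∈ codes, codeRank c ≤ 2 := by decide +kernel

lemma card_codesOfRank_zero : (codesOfRank 0).card = 1 := by decide +kernel

lemma card_codesOfRank_one : (codesOfRank 1).card = 8 := by decide +kernel

lemma card_codesOfRank_two : (codesOfRank 2).card = 7 := by decide +kernel

lemma card_codesOfRank_lt (i : ℕ) : (codesOfRank i).card < 9 := by
  by_cases hi : i ≤ 2
  · interval_cases i
    · simp [card_codesOfRank_zero]
    · simp [card_codesOfRank_one]
    · simp [card_codesOfRank_two]
  · have : codesOfRank i = ∅ := Finset.filter_eq_empty_iff.2 fun c hc h =>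
      hi (h ▸ codeRank_le_two c hc)
    simp [this]

/-- The rank function of the codimension order on `G(4,2,2)`. -/
def coRank : ((Fin 2 → ℂ) ≃ₗ[ℂ] (Fin 2 → ℂ)) → ℕ := codeRank ∘ Function.invFun monomialEquiv

lemma coRank_monomialEquiv (c : Code) : coRank (monomialEquiv c) = codeRank c :=
  congrArg codeRank (Function.leftInverse_invFun monomialEquiv_injective c)

lemma setOf_coRank_eq (i : ℕ) :
    {x | x ∈ Gmpn 4 2 2 ∧ coRank x = i} = monomialEquiv '' codesOfRank i := by
  rw [Gmpn_four_two_two]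
  ext x
  constructor
  · rintro ⟨⟨c, hc, rfl⟩, h⟩
    exact ⟨c, Finset.mem_filter.2 ⟨hc, coRank_monomialEquiv c ▸ h⟩, rfl⟩
  · rintro ⟨c, hc, rfl⟩
    obtain ⟨hc, h⟩ := Finset.mem_filter.1 hc
    exact ⟨⟨c, hc, rfl⟩, (coRank_monomialEquiv c).trans h⟩

lemma ncard_image_monomialEquiv (s : Finset Code) : (monomialEquiv '' s).ncard = s.card := by
  rw [ncard_image_of_injective _ monomialEquiv_injective, ncard_coe_finset]

lemma isAntichainOn_codeAntichain :
    IsAntichainOn (Gmpn 4 2 2) coLe (monomialEquiv '' codeAntichain) := by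
  rw [Gmpn_four_two_two]
  refine ⟨image_mono (Finset.coe_subset.2 codeAntichain_subset), ?_⟩
  rintro _ ⟨c, hc, rfl⟩ _ ⟨d, hd, rfl⟩ hne
  have hcd : c ≠ d := fun h => hne (h ▸ rfl)
  rw [coLe_monomialEquiv, coLe_monomialEquiv]
  exact ⟨not_codeLe_of_mem_codeAntichain c hc d hd hcd,
    not_codeLe_of_mem_codeAntichain d hd c hc hcd.symm⟩

lemma coRank_eq_of_coversOn {x y : (Fin 2 → ℂ) ≃ₗ[ℂ] (Fin 2 → ℂ)}
    (h : CoversOn (Gmpn 4 2 2) coLe x y) : coRank y = coRank x + 1 := by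
  rw [Gmpn_four_two_two] at h
  obtain ⟨⟨c, hc, rfl⟩, ⟨d, hd, rfl⟩, hle, hne, hcov⟩ := h
  rw [coRank_monomialEquiv, coRank_monomialEquiv]
  refine (codeRank_eq_of_covers c hc d hd ((coLe_monomialEquiv c d).1 hle)
    fun h => hne (h ▸ rfl)).resolve_right ?_
  rintro ⟨t, ht, hct, htd, htc, htd'⟩
  rcases hcov _ ⟨t, ht, rfl⟩ ((coLe_monomialEquiv c t).2 hct) ((coLe_monomialEquiv t d).2 htd)
    with h | h
  · exact htc (monomialEquiv_injective h)
  · exact htd' (monomialEquiv_injective h)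

lemma codeLe_scalarCode_zero : ∀ c ∈ codes, codeLe (scalarCode 0) c := by decide +kernel

/-- The codimension order on `G(4,2,2)` is ranked with rank sizes `1, 8, 7`, has two
maximal elements of rank one, and hence has an antichain of size `9` exceeding every rank
size; therefore it is not Sperner. -/
theorem statement13 :
    ∃ r : ((Fin 2 → ℂ) ≃ₗ[ℂ] (Fin 2 → ℂ)) → ℕ,
      (∀ x ∈ Gmpn 4 2 2, ∀ y ∈ Gmpn 4 2 2, CoversOn (Gmpn 4 2 2) coLe x y →
        r y = r x + 1) ∧
      (∀ x ∈ Gmpn 4 2 2, (∀ y ∈ Gmpn 4 2 2, coLe y x → y = x) → r x = 0) ∧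
      (∀ x ∈ Gmpn 4 2 2, r x ≤ 2) ∧
      {x | x ∈ Gmpn 4 2 2 ∧ r x = 0}.ncard = 1 ∧
      {x | x ∈ Gmpn 4 2 2 ∧ r x = 1}.ncard = 8 ∧
      {x | x ∈ Gmpn 4 2 2 ∧ r x = 2}.ncard = 7 ∧
      (∃ a ∈ Gmpn 4 2 2, ∃ b ∈ Gmpn 4 2 2, a ≠ b ∧ r a = 1 ∧ r b = 1 ∧
        (∀ z ∈ Gmpn 4 2 2, coLe a z → z = a) ∧
        (∀ z ∈ Gmpn 4 2 2, coLe b z → z = b) ∧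
        IsAntichainOn (Gmpn 4 2 2) coLe ({x | x ∈ Gmpn 4 2 2 ∧ r x = 2} ∪ {a, b}) ∧
        ({x | x ∈ Gmpn 4 2 2 ∧ r x = 2} ∪ {a, b}).ncard = 9 ∧
        ∀ i, {x | x ∈ Gmpn 4 2 2 ∧ r x = i}.ncard <
          ({x | x ∈ Gmpn 4 2 2 ∧ r x = 2} ∪ {a, b}).ncard) ∧
      ¬ IsSpernerOn (Gmpn 4 2 2) coLe r := by
  have hunion : {x | x ∈ Gmpn 4 2 2 ∧ coRank x = 2} ∪
      {monomialEquiv (scalarCode 1), monomialEquiv (scalarCode 3)} =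
      monomialEquiv '' codeAntichain := by
    rw [setOf_coRank_eq, codeAntichain, Finset.coe_union, image_union, Finset.coe_pair, image_pair]
  have hmem : ∀ {c}, c ∈ codes → monomialEquiv c ∈ Gmpn 4 2 2 := fun {c} hc =>
    Gmpn_four_two_two ▸ ⟨c, hc, rfl⟩
  have hmax : ∀ k : ZMod 4, k = 1 ∨ k = 3 → ∀ z ∈ Gmpn 4 2 2,
      coLe (monomialEquiv (scalarCode k)) z → z = monomialEquiv (scalarCode k) := by
    rw [Gmpn_four_two_two]
    rintro k hk _ ⟨d, hd, rfl⟩ hle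
    rw [scalarCode_maximal k hk d hd ((coLe_monomialEquiv _ d).1 hle)]
  have hlt : ∀ i, {x | x ∈ Gmpn 4 2 2 ∧ coRank x = i}.ncard <
      (monomialEquiv '' codeAntichain).ncard := fun i => by
    rw [setOf_coRank_eq, ncard_image_monomialEquiv, ncard_image_monomialEquiv, card_codeAntichain]
    exact card_codesOfRank_lt i
  refine ⟨coRank, fun x _ y _ => coRank_eq_of_coversOn, ?_, ?_, ?_, ?_, ?_,
    ⟨monomialEquiv (scalarCode 1), hmem (by decide), monomialEquiv (scalarCode 3),
      hmem (by decide), monomialEquiv_injective.ne (by decide), ?_, ?_,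
      hmax 1 (.inl rfl), hmax 3 (.inr rfl), ?_, ?_, ?_⟩, ?_⟩
  · rw [Gmpn_four_two_two]
    rintro _ ⟨c, hc, rfl⟩ hmin
    rw [← hmin _ ⟨scalarCode 0, by decide, rfl⟩
      ((coLe_monomialEquiv _ c).2 (codeLe_scalarCode_zero c hc)), coRank_monomialEquiv]
    decide
  · rw [Gmpn_four_two_two]
    rintro _ ⟨c, hc, rfl⟩
    rw [coRank_monomialEquiv]
    exact codeRank_le_two c hc
  · rw [setOf_coRank_eq, ncard_image_monomialEquiv, card_codesOfRank_zero]
  · rw [setOf_coRank_eq, ncard_image_monomialEquiv, card_codesOfRank_one]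
  · rw [setOf_coRank_eq, ncard_image_monomialEquiv, card_codesOfRank_two]
  · rw [coRank_monomialEquiv]
    decide
  · rw [coRank_monomialEquiv]
    decide
  · rw [hunion]
    exact isAntichainOn_codeAntichain
  · rw [hunion, ncard_image_monomialEquiv, card_codeAntichain]
  · rw [hunion]
    exact hlt
  · intro h
    obtain ⟨i, hi⟩ := h _ isAntichainOn_codeAntichain
    exact (hlt i).not_ge hi

end
end

section
/- Let W = G(10,5,3)^{12}, the direct product of 12 copies of G(10,5,3), regarded as a complex reflection group acting on ℂ^{36}. Then the prefix order pre(W) is not Sperner: it contains an antichain (namely the largest rank, which is rank 37, together with a maximal element of rank 36) that has more elements than any rank of pre(W). -/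
open Module Set

noncomputable section

variable {V : Type*} [AddCommGroup V] [Module ℂ V]

/-- The data of a `3 × 3` monomial matrix with tenth roots of unity as nonzero entries: the matrix
sends `e_j` to `ζ ^ (exp j) • e_(perm j)`, where `ζ = exp (2πi / 10)`. -/
@[ext]
structure MonoMat where
  perm : Equiv.Perm (Fin 3)
  exp : Fin 3 → ZMod 10

namespace MonoMat

instance : Mul MonoMat := ⟨fun g h => ⟨g.perm * h.perm, fun j => g.exp (h.perm j) + h.exp j⟩⟩
instance : One MonoMat := ⟨⟨1, 0⟩⟩
instance : Inv MonoMat := ⟨fun g => ⟨g.perm⁻¹, fun j => -g.exp (g.perm⁻¹ j)⟩⟩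

theorem mul_def (g h : MonoMat) :
    g * h = ⟨g.perm * h.perm, fun j => g.exp (h.perm j) + h.exp j⟩ := rfl

theorem one_def : (1 : MonoMat) = ⟨1, 0⟩ := rfl

theorem inv_def (g : MonoMat) : g⁻¹ = ⟨g.perm⁻¹, fun j => -g.exp (g.perm⁻¹ j)⟩ := rfl

instance : Group MonoMat :=
  Group.ofLeftAxioms
    (fun a b c => by ext <;> simp [mul_def, add_assoc])
    (fun a => by ext <;> simp [mul_def, one_def])
    (fun a => by ext <;> simp [mul_def, one_def, inv_def])

/-- Monomial data as a pair. -/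
def equivProd : MonoMat ≃ Equiv.Perm (Fin 3) × (Fin 3 → ZMod 10) where
  toFun g := (g.perm, g.exp)
  invFun p := ⟨p.1, p.2⟩

instance : Fintype MonoMat := Fintype.ofEquiv _ equivProd.symm

/-- The matrix lies in `G(10,5,3)`. -/
def Valid (g : MonoMat) : Prop := 2 * (g.exp 0 + g.exp 1 + g.exp 2) = 0

instance : DecidablePred Valid := fun g =>
  inferInstanceAs (Decidable (2 * (g.exp 0 + g.exp 1 + g.exp 2) = 0))

theorem valid_iff_sum {g : MonoMat} : g.Valid ↔ 2 * ∑ j, g.exp j = 0 := by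
  rw [Fin.sum_univ_three]; rfl

theorem Valid.mul {g h : MonoMat} (hg : g.Valid) (hh : h.Valid) : (g * h).Valid := by
  rw [valid_iff_sum] at *
  simp only [mul_def, Finset.sum_add_distrib]
  rw [Equiv.sum_comp h.perm g.exp, mul_add, hg, hh, add_zero]

theorem Valid.inv {g : MonoMat} (hg : g.Valid) : g⁻¹.Valid := by
  rw [valid_iff_sum] at *
  simp only [inv_def, Finset.sum_neg_distrib]
  rw [Equiv.sum_comp g.perm⁻¹ g.exp, mul_neg, hg, neg_zero]

theorem valid_one : (1 : MonoMat).Valid := by simp [Valid, one_def]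

/-- The reflection length of a diagonal matrix in `G(10,5,3)`. -/
def lenDiag (a b c : ZMod 10) : ℕ :=
  if a = 0 ∧ b = 0 ∧ c = 0 then 0
  else if (a = 0 ∧ b = 0) ∨ (a = 0 ∧ c = 0) ∨ (b = 0 ∧ c = 0) then 1
  else if a = 0 ∨ b = 0 ∨ c = 0 then if a + b + c = 0 then 2 else 3
  else if a + b + c = 0 then 4
  else if a = 5 ∨ b = 5 ∨ c = 5 then 3 else 5

/-- The reflection length of an element of `G(10,5,3)` whose permutation is a transposition,
where `w` is the weight of the 2-cycle and `f` that of the fixed point. -/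
def lenSwap (w f : ZMod 10) : ℕ :=
  if w = 0 ∨ f = 0 then if w + f = 0 then 1 else 2
  else if w + f = 0 then 3 else 4

/-- The reflection length of an element of `G(10,5,3)`. -/
def len (g : MonoMat) : ℕ :=
  if g.perm 0 = 0 then
    if g.perm 1 = 1 then lenDiag (g.exp 0) (g.exp 1) (g.exp 2)
    else lenSwap (g.exp 1 + g.exp 2) (g.exp 0)
  else if g.perm 1 = 1 then lenSwap (g.exp 0 + g.exp 2) (g.exp 1)
  else if g.perm 2 = 2 then lenSwap (g.exp 0 + g.exp 1) (g.exp 2)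
  else if g.exp 0 + g.exp 1 + g.exp 2 = 0 then 2 else 3

/-- The reflections of `G(10,5,3)` with a transposition as permutation. -/
def swapRefl (i : Fin 3) (k : ZMod 10) : MonoMat :=
  ⟨Equiv.swap (i + 1) (i + 2), fun j => if j = i + 1 then k else if j = i + 2 then -k else 0⟩

/-- The diagonal reflections of `G(10,5,3)`. -/
def diagRefl (i : Fin 3) : MonoMat := ⟨1, fun j => if j = i then 5 else 0⟩

/-- The reflections of `G(10,5,3)`. -/
def IsRefl (t : MonoMat) : Prop := (∃ i k, t = swapRefl i k) ∨ ∃ i, t = diagRefl i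

/-- The matrix `-1`. -/
def negOne : MonoMat := ⟨1, fun _ => 5⟩

theorem eq_mk_vec (g : MonoMat) : g = ⟨g.perm, ![g.exp 0, g.exp 1, g.exp 2]⟩ := by
  ext j
  · rfl
  · fin_cases j <;> rfl

theorem perm_cases : ∀ σ : Equiv.Perm (Fin 3), σ = 1 ∨ σ = Equiv.swap 1 2 ∨ σ = Equiv.swap 2 0 ∨
    σ = Equiv.swap 0 1 ∨ σ = finRotate 3 ∨ σ = (finRotate 3)⁻¹ := by decide

section Finite

set_option maxRecDepth 100000

theorem eq_one_of_len_eq_zero {g : MonoMat} (hg : g.Valid) (h : g.len = 0) : g = 1 := by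
  have key : ∀ σ : Equiv.Perm (Fin 3), ∀ a b c : ZMod 10, Valid ⟨σ, ![a, b, c]⟩ →
      len ⟨σ, ![a, b, c]⟩ ≠ 0 ∨ (σ = 1 ∧ a = 0 ∧ b = 0 ∧ c = 0) := by decide +kernel
  rw [eq_mk_vec g] at hg h ⊢
  obtain h' | ⟨h1, h2, h3, h4⟩ := key _ _ _ _ hg
  · exact absurd h h'
  · rw [h1, h2, h3, h4, one_def]
    congr 1
    ext j; fin_cases j <;> rfl

theorem len_diagRefl_mul_le {g : MonoMat} (hg : g.Valid) (i : Fin 3) :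
    (diagRefl i * g).len ≤ g.len + 1 := by
  have key : ∀ σ : Equiv.Perm (Fin 3), ∀ a b c : ZMod 10, Valid ⟨σ, ![a, b, c]⟩ →
      ∀ i, len (diagRefl i * ⟨σ, ![a, b, c]⟩) ≤ len ⟨σ, ![a, b, c]⟩ + 1 := by decide +kernel
  rw [eq_mk_vec g] at hg ⊢
  exact key _ _ _ _ hg i

theorem len_swapRefl_zero_mul_le {g : MonoMat} (hg : g.Valid) (i : Fin 3) :
    (swapRefl i 0 * g).len ≤ g.len + 1 := by
  have key : ∀ σ : Equiv.Perm (Fin 3), ∀ a b c : ZMod 10, Valid ⟨σ, ![a, b, c]⟩ →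
      ∀ i, len (swapRefl i 0 * ⟨σ, ![a, b, c]⟩) ≤ len ⟨σ, ![a, b, c]⟩ + 1 := by decide +kernel
  rw [eq_mk_vec g] at hg ⊢
  exact key _ _ _ _ hg i

theorem exists_isRefl_len_mul {g : MonoMat} (hg : g.Valid) (h : g.len ≠ 0) :
    ∃ t, IsRefl t ∧ (t * g).len + 1 = g.len := by
  have key : ∀ σ : Equiv.Perm (Fin 3), ∀ a b c : ZMod 10, Valid ⟨σ, ![a, b, c]⟩ →
      len ⟨σ, ![a, b, c]⟩ = 0 ∨
      (∃ i, len (diagRefl i * ⟨σ, ![a, b, c]⟩) + 1 = len ⟨σ, ![a, b, c]⟩) ∨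
      ∃ i k, len (swapRefl i k * ⟨σ, ![a, b, c]⟩) + 1 = len ⟨σ, ![a, b, c]⟩ := by decide +kernel
  rw [eq_mk_vec g] at hg h ⊢
  obtain h' | ⟨i, hi⟩ | ⟨i, k, hi⟩ := key _ _ _ _ hg
  · exact absurd h' h
  · exact ⟨_, Or.inr ⟨i, rfl⟩, hi⟩
  · exact ⟨_, Or.inl ⟨i, k, rfl⟩, hi⟩

theorem len_lt_or_eq_negOne {g : MonoMat} (hg : g.Valid) :
    g.len < 3 + (negOne⁻¹ * g).len ∨ g = negOne := by
  have key : ∀ σ : Equiv.Perm (Fin 3), ∀ a b c : ZMod 10, Valid ⟨σ, ![a, b, c]⟩ →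
      len ⟨σ, ![a, b, c]⟩ < 3 + len (negOne⁻¹ * ⟨σ, ![a, b, c]⟩) ∨
      (σ = 1 ∧ a = 5 ∧ b = 5 ∧ c = 5) := by decide +kernel
  rw [eq_mk_vec g] at hg ⊢
  obtain h' | ⟨h1, h2, h3, h4⟩ := key _ _ _ _ hg
  · exact Or.inl h'
  · right
    rw [h1, h2, h3, h4, negOne]
    congr 1
    ext j; fin_cases j <;> rfl

theorem card_valid_len : ∀ k : Fin 6, (Finset.univ.filter
    fun g : MonoMat => g.Valid ∧ g.len = k).card = ![1, 33, 287, 519, 312, 48] k := by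
  decide +kernel

theorem len_negOne : negOne.len = 3 := by decide +kernel

theorem valid_negOne : negOne.Valid := by decide +kernel

theorem len_one : (1 : MonoMat).len = 0 := by decide +kernel

end Finite

theorem len_lt_six (g : MonoMat) : g.len < 6 := by
  unfold len lenDiag lenSwap
  split_ifs <;> norm_num

/-- Conjugation by a diagonal matrix. -/
def diagConj (d : Fin 3 → ZMod 10) (g : MonoMat) : MonoMat :=
  ⟨g.perm, fun j => g.exp j + d (g.perm j) - d j⟩

theorem diagConj_mul (d : Fin 3 → ZMod 10) (g h : MonoMat) :
    diagConj d (g * h) = diagConj d g * diagConj d h := by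
  ext j
  · rfl
  · simp only [diagConj, mul_def, Equiv.Perm.coe_mul, Function.comp]
    ring

theorem diagConj_neg (d : Fin 3 → ZMod 10) (g : MonoMat) : diagConj d (diagConj (-d) g) = g := by
  ext j
  · rfl
  · simp only [diagConj, Pi.neg_apply]
    ring

theorem len_diagConj (d : Fin 3 → ZMod 10) (g : MonoMat) : (diagConj d g).len = g.len := by
  obtain ⟨σ, a⟩ := g
  obtain h | h | h | h | h | h := perm_cases σ <;> subst h
  · simp [len, diagConj]
  · have h : a 1 + d 2 - d 1 + (a 2 + d 1 - d 2) = a 1 + a 2 := by ring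
    simp [len, diagConj, Equiv.swap_apply_def, h]
  · have h : a 0 + d 2 - d 0 + (a 2 + d 0 - d 2) = a 0 + a 2 := by ring
    simp [len, diagConj, Equiv.swap_apply_def, h]
  · have h : a 0 + d 1 - d 0 + (a 1 + d 0 - d 1) = a 0 + a 1 := by ring
    simp [len, diagConj, Equiv.swap_apply_def, h]
  · have h : a 0 + d 1 - d 0 + (a 1 + d 2 - d 1) + (a 2 + d 0 - d 2) = a 0 + a 1 + a 2 := by ring
    have h0 : finRotate 3 0 = 1 := by decide
    have h1 : finRotate 3 1 = 2 := by decide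
    have h2 : finRotate 3 2 = 0 := by decide
    simp [len, diagConj, h0, h1, h2, h]
  · have h : a 0 + d 2 - d 0 + (a 1 + d 0 - d 1) + (a 2 + d 1 - d 2) = a 0 + a 1 + a 2 := by ring
    have h0 : (finRotate 3)⁻¹ 0 = 2 := by decide
    have h1 : (finRotate 3)⁻¹ 1 = 0 := by decide
    have h2 : (finRotate 3)⁻¹ 2 = 1 := by decide
    have h3 : ¬ (2 : Fin 3) = 0 := by decide
    have h4 : ¬ (1 : Fin 3) = 2 := by decide
    simp only [len, diagConj, h0, h1, h2, h, h3, h4, zero_ne_one, if_false]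

theorem Valid.diagConj {g : MonoMat} (hg : g.Valid) (d : Fin 3 → ZMod 10) :
    (diagConj d g).Valid := by
  rw [valid_iff_sum] at *
  simp only [MonoMat.diagConj, Finset.sum_add_distrib, Finset.sum_sub_distrib]
  rw [Equiv.sum_comp g.perm d, add_sub_cancel_right, hg]

theorem diagConj_swapRefl (i : Fin 3) (k : ZMod 10) :
    diagConj (Pi.single (i + 2) k) (swapRefl i 0) = swapRefl i k := by
  ext j
  · rfl
  · revert i k j
    decide +kernel

theorem len_swapRefl_mul_le {g : MonoMat} (hg : g.Valid) (i : Fin 3) (k : ZMod 10) :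
    (swapRefl i k * g).len ≤ g.len + 1 := by
  have h := len_swapRefl_zero_mul_le (hg.diagConj (-Pi.single (i + 2) k)) i
  rw [← len_diagConj (Pi.single (i + 2) k), diagConj_mul, diagConj_neg, diagConj_swapRefl,
    len_diagConj] at h
  exact h

theorem IsRefl.len_mul_le {t g : MonoMat} (ht : IsRefl t) (hg : g.Valid) :
    (t * g).len ≤ g.len + 1 := by
  obtain ⟨i, k, rfl⟩ | ⟨i, rfl⟩ := ht
  · exact len_swapRefl_mul_le hg i k
  · exact len_diagRefl_mul_le hg i

theorem IsRefl.mul_self {t : MonoMat} (ht : IsRefl t) : t * t = 1 := by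
  obtain ⟨i, k, rfl⟩ | ⟨i, rfl⟩ := ht
  · rw [mul_def, one_def]
    congr 1
    · simp [swapRefl]
    · ext j
      revert i k j
      decide +kernel
  · rw [mul_def, one_def]
    congr 1
    ext j
    revert i j
    decide +kernel

theorem IsRefl.valid {t : MonoMat} (ht : IsRefl t) : t.Valid := by
  obtain ⟨i, k, rfl⟩ | ⟨i, rfl⟩ := ht
  · revert i k
    decide +kernel
  · revert i
    decide +kernel

/-- `z k = exp (2πi k / 10)`. -/
local notation "z" => (ZMod.stdAddChar (N := 10))

theorem z_eq_one_iff {k : ZMod 10} : z k = 1 ↔ k = 0 := by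
  rw [← AddChar.map_zero_eq_one z]
  exact ZMod.injective_stdAddChar.eq_iff

theorem z_ne_zero (k : ZMod 10) : z k ≠ 0 :=
  (AddChar.val_isUnit z k).ne_zero

/-- The linear automorphism given by monomial data. -/
def toLin : MonoMat →* ((Fin 3 → ℂ) ≃ₗ[ℂ] (Fin 3 → ℂ)) where
  toFun g :=
    { toFun := fun x r => z (g.exp (g.perm.symm r)) * x (g.perm.symm r)
      invFun := fun y j => z (-g.exp j) * y (g.perm j)
      map_add' := fun x y => by ext r; simp [mul_add]
      map_smul' := fun c x => by ext r; simp [mul_left_comm]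
      left_inv := fun x => by
        ext j
        simp [← mul_assoc, ← AddChar.map_add_eq_mul]
      right_inv := fun y => by
        ext j
        simp [← mul_assoc, ← AddChar.map_add_eq_mul] }
  map_one' := by ext x r; simp [one_def, ← Equiv.Perm.inv_def]
  map_mul' g h := by
    ext x r
    simp [mul_def, AddChar.map_add_eq_mul, ← Equiv.Perm.inv_def, mul_assoc]

theorem toLin_apply (g : MonoMat) (x : Fin 3 → ℂ) (r : Fin 3) :
    toLin g x r = z (g.exp (g.perm.symm r)) * x (g.perm.symm r) := rfl

theorem toLin_single (g : MonoMat) (j : Fin 3) :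
    toLin g (Pi.single j 1) = z (g.exp j) • (Pi.single (g.perm j) 1 : Fin 3 → ℂ) := by
  ext r
  obtain ⟨k, rfl⟩ := g.perm.surjective r
  by_cases h : k = j
  · subst h; simp [toLin_apply]
  · simp [toLin_apply, h]

theorem toLin_injective : Function.Injective toLin := by
  rw [injective_iff_map_eq_one]
  intro g hg
  have h : ∀ j, z (g.exp j) • (Pi.single (g.perm j) 1 : Fin 3 → ℂ) = Pi.single j 1 := by
    intro j
    rw [← toLin_single, hg]
    rfl
  have hp : ∀ j, g.perm j = j := by
    intro j
    by_contra hj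
    have := congrFun (h j) j
    simp [Ne.symm hj] at this
  ext j
  · simp [hp, one_def]
  · have := congrFun (h j) j
    rw [hp j] at this
    simpa [z_eq_one_iff, one_def] using this

theorem mem_Gmpn_iff {w : (Fin 3 → ℂ) ≃ₗ[ℂ] (Fin 3 → ℂ)} :
    w ∈ Gmpn 10 5 3 ↔ ∃ g : MonoMat, g.Valid ∧ toLin g = w := by
  constructor
  · rintro ⟨σ, a, ha, hp, hw⟩
    have hz : IsPrimitiveRoot (z 1) 10 := by
      refine ⟨?_, fun l hl => ?_⟩
      · rw [← AddChar.map_nsmul_eq_pow, z_eq_one_iff]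
        rfl
      · rw [← AddChar.map_nsmul_eq_pow, z_eq_one_iff, nsmul_one] at hl
        exact (ZMod.natCast_eq_zero_iff l 10).1 hl
    have hb : ∀ j, ∃ k, z k = a j := by
      intro j
      obtain ⟨i, -, hi⟩ := hz.eq_pow_of_pow_eq_one (ha j)
      exact ⟨i • 1, by rw [AddChar.map_nsmul_eq_pow, hi]⟩
    choose b hb using hb
    refine ⟨⟨σ, b⟩, ?_, ?_⟩
    · rw [Fin.prod_univ_three] at hp
      simp only [Valid, ← z_eq_one_iff, two_mul, AddChar.map_add_eq_mul, hb]
      rw [← sq]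
      exact hp
    · apply LinearEquiv.toLinearMap_injective
      refine (Pi.basisFun ℂ (Fin 3)).ext fun j => ?_
      simp only [Pi.basisFun_apply, LinearEquiv.coe_coe]
      rw [toLin_single, hw, hb]
  · rintro ⟨g, hg, rfl⟩
    refine ⟨g.perm, fun j => z (g.exp j), fun i => ?_, ?_, toLin_single g⟩
    · rw [← AddChar.map_nsmul_eq_pow, z_eq_one_iff]
      generalize g.exp i = k
      revert k
      decide
    · rw [Fin.prod_univ_three, ← AddChar.map_add_eq_mul, ← AddChar.map_add_eq_mul,
        ← AddChar.map_nsmul_eq_pow, z_eq_one_iff, nsmul_eq_mul]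
      exact hg

/-- The entry in row `r` and column `j` of the matrix minus the identity. -/
def subOneEntry (g : MonoMat) (r j : Fin 3) : ℂ :=
  toLin g (Pi.single j 1) r - (Pi.single j 1 : Fin 3 → ℂ) r

theorem subOneEntry_eq (g : MonoMat) (r j : Fin 3) : subOneEntry g r j =
    (if r = g.perm j then z (g.exp j) else 0) - if r = j then 1 else 0 := by
  rw [subOneEntry, toLin_single]
  simp [Pi.single_apply]

theorem exists_subOneEntry_ne_zero {g : MonoMat} (hg : g ≠ 1) : ∃ r j, subOneEntry g r j ≠ 0 := by
  contrapose! hg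
  apply toLin_injective
  rw [map_one]
  apply LinearEquiv.toLinearMap_injective
  refine (Pi.basisFun ℂ (Fin 3)).ext fun j => ?_
  ext r
  simpa [subOneEntry, sub_eq_zero] using hg r j

theorem isRefl_swap {a : Fin 3 → ZMod 10} (i : Fin 3) (h0 : a i = 0)
    (h : a (i + 2) = -a (i + 1)) : IsRefl ⟨Equiv.swap (i + 1) (i + 2), a⟩ := by
  refine Or.inl ⟨i, a (i + 1), ?_⟩
  ext j
  · rfl
  · fin_cases i <;> fin_cases j <;> simp_all [swapRefl]

theorem isRefl_of_minors {g : MonoMat} (hv : g.Valid) (hg : g ≠ 1)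
    (h : ∀ r s j k, subOneEntry g r j * subOneEntry g s k =
      subOneEntry g s j * subOneEntry g r k) : IsRefl g := by
  obtain ⟨σ, a⟩ := g
  simp only [subOneEntry_eq] at h
  have two : ∀ k : ZMod 10, 2 * k = 0 → k = 0 ∨ k = 5 := by decide
  have hmul : ∀ k l, 1 = z k * z l → l = -k := by
    intro k l hkl
    rw [← AddChar.map_add_eq_mul, eq_comm, z_eq_one_iff] at hkl
    exact (neg_eq_of_add_eq_zero_right hkl).symm
  have h01 := h 0 1 0 1
  have h02 := h 0 2 0 2
  have h12 := h 1 2 1 2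
  obtain hs | hs | hs | hs | hs | hs := perm_cases σ <;> subst hs
  · simp [sub_eq_zero, z_eq_one_iff] at h01 h02 h12
    have aux : ∀ i, (∀ j, j ≠ i → a j = 0) → IsRefl ⟨1, a⟩ := by
      intro i hi
      have hsum : ∑ j, a j = a i := Finset.sum_eq_single i (fun j _ hj => hi j hj) (by simp)
      rw [valid_iff_sum] at hv
      simp only [hsum] at hv
      obtain h0 | h5 := two _ hv
      · refine absurd ?_ hg
        ext j
        · rfl
        · by_cases hj : j = i
          · rw [hj]; exact h0
          · exact hi j hj
      · refine Or.inr ⟨i, ?_⟩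
        ext j
        · rfl
        · by_cases hj : j = i
          · simp [diagRefl, hj, h5]
          · simp [diagRefl, hj, hi j hj]
    by_cases h0 : a 0 = 0
    · by_cases h1 : a 1 = 0
      · refine aux 2 fun j hj => ?_
        fin_cases j <;> simp_all
      · refine aux 1 fun j hj => ?_
        fin_cases j <;> simp_all
    · refine aux 0 fun j hj => ?_
      fin_cases j <;> simp_all
  · simp [Equiv.swap_apply_def, sub_eq_zero] at h01 h02 h12
    exact isRefl_swap 0 (z_eq_one_iff.1 h01.symm) (hmul _ _ h12)
  · simp [Equiv.swap_apply_def, sub_eq_zero] at h01 h02 h12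
    exact isRefl_swap 1 (z_eq_one_iff.1 h01.symm) (hmul _ _ (h02.trans (mul_comm _ _)))
  · simp [Equiv.swap_apply_def, sub_eq_zero] at h01 h02 h12
    exact isRefl_swap 2 (z_eq_one_iff.1 h02.symm) (hmul _ _ h01)
  · have h0 : finRotate 3 0 = 1 := by decide
    have h1 : finRotate 3 1 = 2 := by decide
    have h2 : finRotate 3 2 = 0 := by decide
    have := h 0 2 0 1
    simp [h0, h1, z_ne_zero] at this
  · have h0 : (finRotate 3)⁻¹ 0 = 2 := by decide
    have h1 : (finRotate 3)⁻¹ 1 = 0 := by decide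
    have h2 : (finRotate 3)⁻¹ 2 = 1 := by decide
    have := h 0 1 0 2
    simp [h0, h2, z_ne_zero] at this

end MonoMat

section Reflections

variable {V : Type*} [AddCommGroup V] [Module ℂ V]

theorem fixCodim_eq_finrank_range [FiniteDimensional ℂ V] (w : V ≃ₗ[ℂ] V) :
    fixCodim w = finrank ℂ (LinearMap.range ((w : V →ₗ[ℂ] V) - 1)) := by
  rw [fixCodim, ← LinearMap.finrank_range_add_finrank_ker ((w : V →ₗ[ℂ] V) - 1),
    Nat.add_sub_cancel]

theorem isReflection_of_sub_eq_smul [FiniteDimensional ℂ V] {w : V ≃ₗ[ℂ] V} {v : V} (f : V → ℂ)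
    (h : ∀ x, w x - x = f x • v) (hw : w ≠ 1) : IsReflection w := by
  have hx : ∃ x, w x - x ≠ 0 := by
    contrapose! hw
    ext x
    exact sub_eq_zero.1 (hw x)
  obtain ⟨x, hx⟩ := hx
  rw [IsReflection, fixCodim_eq_finrank_range, finrank_eq_one_iff']
  refine ⟨⟨w x - x, x, rfl⟩, fun h0 => hx (congrArg Subtype.val h0), ?_⟩
  rintro ⟨_, y, rfl⟩
  have hfx : f x ≠ 0 := fun h0 => hx (by rw [h, h0, zero_smul])
  refine ⟨f y / f x, Subtype.ext ?_⟩
  change (f y / f x) • (w x - x) = w y - y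
  rw [h, h, smul_smul, div_mul_cancel₀ _ hfx]

theorem IsReflection.exists_sub_eq_smul [FiniteDimensional ℂ V] {w : V ≃ₗ[ℂ] V}
    (hw : IsReflection w) : ∃ v, ∀ x, ∃ c : ℂ, w x - x = c • v := by
  rw [IsReflection, fixCodim_eq_finrank_range, finrank_eq_one_iff'] at hw
  obtain ⟨v, -, hv⟩ := hw
  refine ⟨v, fun x => ?_⟩
  obtain ⟨c, hc⟩ := hv ⟨w x - x, x, rfl⟩
  exact ⟨c, (congrArg Subtype.val hc).symm⟩

theorem not_isReflection_one [FiniteDimensional ℂ V] : ¬ IsReflection (1 : V ≃ₗ[ℂ] V) := by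
  rw [IsReflection, fixCodim_eq_finrank_range]
  have h : ((1 : V ≃ₗ[ℂ] V) : V →ₗ[ℂ] V) - 1 = 0 := sub_eq_zero.2 rfl
  rw [h, LinearMap.range_zero, finrank_bot]
  exact zero_ne_one

end Reflections

namespace MonoMat

local notation "z" => (ZMod.stdAddChar (N := 10))

variable {ι : Type}

/-- The automorphism of `ι → Fin 3 → ℂ` acting blockwise by monomial matrices. -/
def piLin : (ι → MonoMat) →* ((ι → Fin 3 → ℂ) ≃ₗ[ℂ] (ι → Fin 3 → ℂ)) where
  toFun g := LinearEquiv.piCongrRight fun i => toLin (g i)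
  map_one' := by ext x i r; simp
  map_mul' g h := by ext x i r; simp

theorem piLin_apply (g : ι → MonoMat) (x : ι → Fin 3 → ℂ) (i : ι) :
    piLin g x i = toLin (g i) (x i) := rfl

theorem piLin_injective : Function.Injective (piLin (ι := ι)) := by
  classical
  intro g h hgh
  funext i
  apply toLin_injective
  ext1 x
  have := congrFun (LinearEquiv.congr_fun hgh (Pi.single i x)) i
  simpa [piLin_apply] using this

/-- The group `G(10,5,3)^ι`. -/
def piSet (ι : Type) : Set ((ι → Fin 3 → ℂ) ≃ₗ[ℂ] (ι → Fin 3 → ℂ)) :=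
  {x | ∃ g : ι → MonoMat, (∀ i, (g i).Valid) ∧ piLin g = x}

theorem piLin_mem {g : ι → MonoMat} (hg : ∀ i, (g i).Valid) : piLin g ∈ piSet ι := ⟨g, hg, rfl⟩

theorem piSet_eq (ι : Type) : {x | ∃ w : ι → ((Fin 3 → ℂ) ≃ₗ[ℂ] (Fin 3 → ℂ)),
    (∀ i, w i ∈ Gmpn 10 5 3) ∧ x = LinearEquiv.piCongrRight w} = piSet ι := by
  ext x
  constructor
  · rintro ⟨w, hw, rfl⟩
    choose g hg hgw using fun i => mem_Gmpn_iff.1 (hw i)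
    refine ⟨g, hg, ?_⟩
    rw [← funext hgw]
    rfl
  · rintro ⟨g, hg, rfl⟩
    exact ⟨fun i => toLin (g i), fun i => mem_Gmpn_iff.2 ⟨g i, hg i, rfl⟩, rfl⟩

theorem IsRefl.ne_one {t : MonoMat} (ht : IsRefl t) : t ≠ 1 := by
  obtain ⟨i, k, rfl⟩ | ⟨i, rfl⟩ := ht
  · intro h
    have hp : Equiv.swap (i + 1) (i + 2) = 1 := congrArg perm h
    rw [Equiv.swap_eq_one_iff, add_right_inj] at hp
    exact absurd hp (by decide)
  · intro h
    have := congrFun (congrArg exp h) i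
    simp only [diagRefl, one_def, if_true, Pi.zero_apply] at this
    exact absurd this (by decide)

theorem IsRefl.toLin_sub {t : MonoMat} (ht : IsRefl t) :
    ∃ (f : (Fin 3 → ℂ) → ℂ) (v : Fin 3 → ℂ), ∀ x, toLin t x - x = f x • v := by
  obtain ⟨i, k, rfl⟩ | ⟨i, rfl⟩ := ht
  · refine ⟨fun x => x (i + 1) - z (-k) * x (i + 2),
      z k • Pi.single (i + 2) 1 - Pi.single (i + 1) 1, fun x => ?_⟩
    have hk : z k * z (-k) = 1 := by
      rw [← AddChar.map_add_eq_mul, add_neg_cancel, AddChar.map_zero_eq_one]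
    have h1 : toLin (swapRefl i k) x (i + 1) = z (-k) * x (i + 2) := by
      simp [toLin_apply, swapRefl]
    have h2 : toLin (swapRefl i k) x (i + 2) = z k * x (i + 1) := by
      simp [toLin_apply, swapRefl]
    have h0 : toLin (swapRefl i k) x i = x i := by
      fin_cases i <;> simp [toLin_apply, swapRefl, Equiv.swap_apply_def]
    have cases : ∀ i r : Fin 3, r = i ∨ r = i + 1 ∨ r = i + 2 := by decide
    ext r
    obtain rfl | rfl | rfl := cases i r
    · simp [h0]
    · simp [h1]
    · simp only [Pi.sub_apply, Pi.smul_apply, h2, smul_eq_mul, Pi.single_eq_same, mul_one]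
      rw [Pi.single_eq_of_ne (by simp)]
      linear_combination x (i + 2) * hk
  · refine ⟨fun x => (z 5 - 1) * x i, Pi.single i 1, fun x => ?_⟩
    ext r
    by_cases hr : r = i
    · subst hr
      simp [toLin_apply, diagRefl, ← Equiv.Perm.inv_def]
      ring
    · simp [toLin_apply, diagRefl, hr, ← Equiv.Perm.inv_def]

theorem valid_mulSingle_mul [DecidableEq ι] {t : MonoMat} (ht : t.Valid) (i : ι) {g : ι → MonoMat}
    (hg : ∀ j, (g j).Valid) (j : ι) : ((Pi.mulSingle i t * g : ι → MonoMat) j).Valid := by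
  by_cases hj : j = i
  · subst hj; simpa using ht.mul (hg j)
  · simpa [hj] using hg j

theorem piLin_sub_single [DecidableEq ι] (g : ι → MonoMat) (i i' : ι) (j r : Fin 3) :
    (piLin g (Pi.single i (Pi.single j 1)) - Pi.single i (Pi.single j 1) : ι → Fin 3 → ℂ) i' r =
      if i' = i then subOneEntry (g i) r j else 0 := by
  by_cases h : i' = i
  · subst h; simp [piLin_apply, subOneEntry]
  · simp [piLin_apply, h]

variable [Fintype ι]

/-- The reflection length of an element of `G(10,5,3)^ι`. -/
def totalLen (g : ι → MonoMat) : ℕ := ∑ i, (g i).len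

theorem totalLen_eq_zero {g : ι → MonoMat} (hg : ∀ i, (g i).Valid) (h : totalLen g = 0) :
    g = 1 := by
  funext i
  exact eq_one_of_len_eq_zero (hg i) (Finset.sum_eq_zero_iff.1 h i (Finset.mem_univ i))

variable [DecidableEq ι]

theorem IsRefl.isReflection_piLin {t : MonoMat} (ht : IsRefl t) (i : ι) :
    IsReflection (piLin (Pi.mulSingle i t)) := by
  obtain ⟨f, v, h⟩ := ht.toLin_sub
  refine isReflection_of_sub_eq_smul (v := Pi.single i v) (fun x => f (x i)) (fun x => ?_) ?_
  · funext j
    by_cases hj : j = i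
    · subst hj
      simpa [piLin_apply] using h (x j)
    · simp [piLin_apply, hj]
  · rw [← map_one piLin, piLin_injective.ne_iff]
    simpa using ht.ne_one

theorem exists_isRefl_of_isReflection {g : ι → MonoMat} (hg : ∀ i, (g i).Valid)
    (h : IsReflection (piLin g)) : ∃ i t, IsRefl t ∧ g = Pi.mulSingle i t := by
  obtain ⟨v, hv⟩ := h.exists_sub_eq_smul
  have minor : ∀ i₁ i₂ j₁ j₂ p₁ p₂ r₁ r₂,
      (if p₁ = i₁ then subOneEntry (g i₁) r₁ j₁ else 0) *
        (if p₂ = i₂ then subOneEntry (g i₂) r₂ j₂ else 0) =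
      (if p₂ = i₁ then subOneEntry (g i₁) r₂ j₁ else 0) *
        (if p₁ = i₂ then subOneEntry (g i₂) r₁ j₂ else 0) := by
    intro i₁ i₂ j₁ j₂ p₁ p₂ r₁ r₂
    simp only [← piLin_sub_single]
    obtain ⟨c₁, h₁⟩ := hv (Pi.single i₁ (Pi.single j₁ 1))
    obtain ⟨c₂, h₂⟩ := hv (Pi.single i₂ (Pi.single j₂ 1))
    rw [h₁, h₂]
    simp only [Pi.smul_apply, smul_eq_mul]
    ring
  have hg1 : ∃ i, g i ≠ 1 := by
    by_contra! h1
    rw [show g = 1 from funext h1, map_one] at h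
    exact not_isReflection_one h
  obtain ⟨i, hi⟩ := hg1
  refine ⟨i, g i, isRefl_of_minors (hg i) hi fun r s j k => ?_, ?_⟩
  · simpa using minor i i j k i i r s
  · funext i'
    by_cases hne : i' = i
    · subst hne; simp
    · rw [Pi.mulSingle_eq_of_ne hne]
      by_contra h1
      obtain ⟨r₁, j₁, e₁⟩ := exists_subOneEntry_ne_zero hi
      obtain ⟨r₂, j₂, e₂⟩ := exists_subOneEntry_ne_zero h1
      have := minor i i' j₁ j₂ i i' r₁ r₂
      simp [hne, e₁, e₂] at this

theorem totalLen_mulSingle_mul (i : ι) (t : MonoMat) (g : ι → MonoMat) :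
    totalLen (Pi.mulSingle i t * g) + (g i).len = totalLen g + (t * g i).len := by
  have h : ∑ j ∈ Finset.univ.erase i, ((Pi.mulSingle i t * g : ι → MonoMat) j).len =
      ∑ j ∈ Finset.univ.erase i, (g j).len :=
    Finset.sum_congr rfl fun j hj => by simp [Finset.ne_of_mem_erase hj]
  rw [totalLen, totalLen, ← Finset.add_sum_erase _ _ (Finset.mem_univ i),
    ← Finset.add_sum_erase _ (fun j => (g j).len) (Finset.mem_univ i), h]
  simp only [Pi.mul_apply, Pi.mulSingle_eq_same]
  ring

theorem exists_reflection_word (n : ℕ) (g : ι → MonoMat) (hg : ∀ i, (g i).Valid)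
    (hn : totalLen g = n) : ∃ l : List ((ι → Fin 3 → ℂ) ≃ₗ[ℂ] (ι → Fin 3 → ℂ)), l.length = n ∧
      (∀ t ∈ l, t ∈ piSet ι ∧ IsReflection t) ∧ l.prod = piLin g := by
  induction n generalizing g with
  | zero => exact ⟨[], rfl, by simp, by simp [totalLen_eq_zero hg hn]⟩
  | succ n ih =>
    have hex : ∃ i, (g i).len ≠ 0 := by
      by_contra! h0
      simp [totalLen, h0] at hn
    obtain ⟨i, hi⟩ := hex
    obtain ⟨t, ht, hlen⟩ := exists_isRefl_len_mul (hg i) hi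
    have hsum := totalLen_mulSingle_mul i t g
    have hv := valid_mulSingle_mul ht.valid i hg
    obtain ⟨l, hl, hl', hprod⟩ := ih _ hv (by linarith)
    refine ⟨piLin (Pi.mulSingle i t) :: l, by simp [hl], ?_, ?_⟩
    · intro s hs
      obtain rfl | hs := List.mem_cons.1 hs
      · refine ⟨piLin_mem fun j => ?_, ht.isReflection_piLin i⟩
        simpa using valid_mulSingle_mul ht.valid i (g := 1) (fun _ => valid_one) j
      · exact hl' s hs
    · rw [List.prod_cons, hprod, ← map_mul, ← mul_assoc, ← Pi.mulSingle_mul, ht.mul_self,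
        Pi.mulSingle_one, one_mul]

theorem exists_totalLen_le_of_word (l : List ((ι → Fin 3 → ℂ) ≃ₗ[ℂ] (ι → Fin 3 → ℂ)))
    (hl : ∀ t ∈ l, t ∈ piSet ι ∧ IsReflection t) :
    ∃ g : ι → MonoMat, (∀ i, (g i).Valid) ∧ piLin g = l.prod ∧ totalLen g ≤ l.length := by
  induction l with
  | nil => exact ⟨1, fun _ => valid_one, by simp, by simp [totalLen, len_one]⟩
  | cons s l ih =>
    obtain ⟨g, hg, hprod, hlen⟩ := ih fun t ht => hl t (List.mem_cons_of_mem _ ht)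
    obtain ⟨⟨u, hu, rfl⟩, hs⟩ := hl s List.mem_cons_self
    obtain ⟨i, t, ht, rfl⟩ := exists_isRefl_of_isReflection hu hs
    have hv := valid_mulSingle_mul ht.valid i hg
    refine ⟨_, hv, ?_, ?_⟩
    · rw [map_mul, hprod, List.prod_cons]
    · have h1 := totalLen_mulSingle_mul i t g
      have h2 := ht.len_mul_le (hg i)
      rw [List.length_cons]
      linarith

theorem reflLen_piLin {g : ι → MonoMat} (hg : ∀ i, (g i).Valid) :
    reflLen (piSet ι) (piLin g) = totalLen g := by
  have hmem := exists_reflection_word _ g hg rfl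
  apply le_antisymm
  · exact Nat.sInf_le hmem
  · obtain ⟨l, hl, hl', hprod⟩ := Nat.sInf_mem (s := {k | ∃ l : List
      ((ι → Fin 3 → ℂ) ≃ₗ[ℂ] (ι → Fin 3 → ℂ)), l.length = k ∧
      (∀ t ∈ l, t ∈ piSet ι ∧ IsReflection t) ∧ l.prod = piLin g}) ⟨_, hmem⟩
    obtain ⟨g', hg', hprod', hlen⟩ := exists_totalLen_le_of_word l hl'
    rw [piLin_injective (hprod'.trans hprod)] at hlen
    exact hlen.trans hl.le

/-- The number of elements of `G(10,5,3)^ι` of reflection length `k`. -/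
theorem ncard_rank (k : ℕ) : {x | x ∈ piSet ι ∧ reflLen (piSet ι) x = k}.ncard =
    ((Fintype.piFinset fun _ : ι => Finset.univ.filter Valid).filter
      fun g => totalLen g = k).card := by
  rw [← Set.ncard_coe_finset, ← Set.ncard_image_of_injective _ piLin_injective]
  congr 1
  ext x
  constructor
  · rintro ⟨⟨g, hg, rfl⟩, hk⟩
    rw [reflLen_piLin hg] at hk
    exact ⟨g, by simpa [hk] using hg, rfl⟩
  · rintro ⟨g, hg, rfl⟩
    simp only [Finset.coe_filter, Fintype.mem_piFinset, Finset.mem_filter, Finset.mem_univ,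
      true_and, Set.mem_ofPred_eq] at hg
    exact ⟨piLin_mem hg.1, by rw [reflLen_piLin hg.1, hg.2]⟩

open Polynomial in
/-- The rank generating polynomial of `G(10,5,3)`. -/
theorem sum_X_pow_len : ∑ g ∈ Finset.univ.filter Valid, (X : ℕ[X]) ^ g.len =
    1 + 33 * X + 287 * X ^ 2 + 519 * X ^ 3 + 312 * X ^ 4 + 48 * X ^ 5 := by
  rw [← Finset.sum_fiberwise_of_maps_to (t := Finset.range 6) (g := len)
    (fun g _ => Finset.mem_range.2 g.len_lt_six)]
  have h : ∀ k ∈ Finset.range 6, ∑ g ∈ (Finset.univ.filter Valid).filter (fun g => g.len = k),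
      (X : ℕ[X]) ^ g.len =
      ((Finset.univ.filter fun g : MonoMat => g.Valid ∧ g.len = k).card : ℕ[X]) * X ^ k := by
    intro k _
    rw [Finset.filter_filter, ← nsmul_eq_mul, ← Finset.sum_const]
    exact Finset.sum_congr rfl fun g hg => by rw [(Finset.mem_filter.1 hg).2.2]
  rw [Finset.sum_congr rfl h]
  have c0 := card_valid_len 0
  have c1 := card_valid_len 1
  have c2 := card_valid_len 2
  have c3 := card_valid_len 3
  have c4 := card_valid_len 4
  have c5 := card_valid_len 5
  simp at c0 c1 c2 c3 c4 c5
  simp [Finset.sum_range_succ, c0, c1, c2, c3, c4, c5]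

open Polynomial in
theorem coeff_sum_X_pow_len_pow (k : ℕ) :
    ((∑ g ∈ Finset.univ.filter Valid, (X : ℕ[X]) ^ g.len) ^ Fintype.card ι).coeff k =
      {x | x ∈ piSet ι ∧ reflLen (piSet ι) x = k}.ncard := by
  rw [ncard_rank, ← Finset.card_univ, ← Finset.prod_const, Finset.prod_univ_sum, finsetSum_coeff,
    Finset.card_filter]
  refine Finset.sum_congr rfl fun g _ => ?_
  rw [Finset.prod_pow_eq_pow_sum, coeff_X_pow]
  exact if_congr eq_comm rfl rfl

end MonoMat

section Kronecker

open Polynomial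

theorem coeff_le_eval_one (p : ℕ[X]) (k : ℕ) : p.coeff k ≤ p.eval 1 := by
  rw [eval_eq_sum]
  simp only [one_pow, mul_one]
  by_cases h : k ∈ p.support
  · exact Finset.single_le_sum (f := fun i => p.coeff i) (fun _ _ => Nat.zero_le _) h
  · rw [notMem_support_iff.1 h]
    exact Nat.zero_le _

/-- Kronecker substitution: coefficients can be read off as digits of a value. -/
theorem coeff_eq_eval_div_pow_mod {B : ℕ} {p : ℕ[X]} (hp : ∀ k, p.coeff k < B) (k : ℕ) :
    p.coeff k = p.eval B / B ^ k % B := by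
  have hB : 0 < B := (Nat.zero_le _).trans_lt (hp 0)
  have heval : p.eval B = p.coeff 0 + B * p.divX.eval B := by
    conv_lhs => rw [← divX_mul_X_add p]
    simp [mul_comm, add_comm]
  induction k generalizing p with
  | zero => rw [heval, pow_zero, Nat.div_one, Nat.add_mul_mod_self_left, Nat.mod_eq_of_lt (hp 0)]
  | succ k ih =>
    have hd : ∀ k, p.divX.coeff k < B := fun k => by rw [coeff_divX]; exact hp _
    have hevald : p.divX.eval B = p.divX.coeff 0 + B * p.divX.divX.eval B := by
      conv_lhs => rw [← divX_mul_X_add p.divX]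
      simp [mul_comm, add_comm]
    rw [← coeff_divX, ih hd hevald, heval, pow_succ', ← Nat.div_div_eq_div_mul,
      Nat.add_mul_div_left _ _ hB, Nat.div_eq_of_lt (hp 0), zero_add]

end Kronecker

namespace MonoMat

/-- The number of elements of `G(10,5,3)^12` of reflection length `k`, as a digit in base
`10 ^ 40` of a value of the generating function. -/
theorem ncard_rank_twelve (k : ℕ) :
    {x | x ∈ piSet (Fin 12) ∧ reflLen (piSet (Fin 12)) x = k}.ncard =
      (1 + 33 * 10 ^ 40 + 287 * (10 ^ 40) ^ 2 + 519 * (10 ^ 40) ^ 3 + 312 * (10 ^ 40) ^ 4 +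
        48 * (10 ^ 40) ^ 5) ^ 12 / (10 ^ 40) ^ k % 10 ^ 40 := by
  rw [← coeff_sum_X_pow_len_pow, sum_X_pow_len, Fintype.card_fin,
    coeff_eq_eval_div_pow_mod (B := 10 ^ 40)]
  · simp
  · intro k
    refine (coeff_le_eval_one _ k).trans_lt ?_
    simp

theorem ncard_rank_le (k : ℕ) :
    {x | x ∈ piSet (Fin 12) ∧ reflLen (piSet (Fin 12)) x = k}.ncard ≤
      {x | x ∈ piSet (Fin 12) ∧ reflLen (piSet (Fin 12)) x = 37}.ncard := by
  rw [ncard_rank_twelve, ncard_rank_twelve]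
  by_cases hk : k < 61
  · have key : ∀ k : Fin 61, (1 + 33 * 10 ^ 40 + 287 * (10 ^ 40) ^ 2 + 519 * (10 ^ 40) ^ 3 +
        312 * (10 ^ 40) ^ 4 + 48 * (10 ^ 40) ^ 5) ^ 12 / (10 ^ 40) ^ (k : ℕ) % 10 ^ 40 ≤
        (1 + 33 * 10 ^ 40 + 287 * (10 ^ 40) ^ 2 + 519 * (10 ^ 40) ^ 3 +
        312 * (10 ^ 40) ^ 4 + 48 * (10 ^ 40) ^ 5) ^ 12 / (10 ^ 40) ^ 37 % 10 ^ 40 := by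
      decide +kernel
    exact key ⟨k, hk⟩
  · rw [Nat.div_eq_of_lt, Nat.zero_mod]
    · exact Nat.zero_le _
    · refine lt_of_lt_of_le ?_ (Nat.pow_le_pow_right (by norm_num) (not_lt.1 hk))
      norm_num

theorem finite_piSet (ι : Type) [Fintype ι] : (piSet ι).Finite := by
  classical
  refine (Set.finite_range (piLin (ι := ι))).subset ?_
  rintro _ ⟨g, -, rfl⟩
  exact ⟨g, rfl⟩

theorem preLe_piLin {ι : Type} [Fintype ι] [DecidableEq ι] {g h : ι → MonoMat}
    (hg : ∀ i, (g i).Valid) (hh : ∀ i, (h i).Valid) :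
    preLe (piSet ι) (piLin g) (piLin h) ↔ totalLen g + totalLen (g⁻¹ * h) = totalLen h := by
  have hv : ∀ i, ((g⁻¹ * h) i).Valid := fun i => (hg i).inv.mul (hh i)
  rw [preLe, ← map_inv, ← map_mul, reflLen_piLin hg, reflLen_piLin hh, reflLen_piLin hv]

/-- The tuple `-1` is maximal in the prefix order. -/
theorem eq_negOne_of_preLe {ι : Type} [Fintype ι] [DecidableEq ι] {y}
    (hy : y ∈ piSet ι) (h : preLe (piSet ι) (piLin fun _ => negOne) y) :
    y = piLin fun _ => negOne := by
  obtain ⟨g, hg, rfl⟩ := hy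
  rw [preLe_piLin (fun _ => valid_negOne) hg] at h
  congr 1
  by_contra hne
  obtain ⟨i, hi⟩ := Function.ne_iff.1 hne
  have key : ∀ j, (g j).len < 3 + (negOne⁻¹ * g j).len ∨ g j = negOne :=
    fun j => len_lt_or_eq_negOne (hg j)
  have hlt : ∑ j, (g j).len < ∑ j, (negOne.len + (negOne⁻¹ * g j).len) := by
    rw [len_negOne]
    refine Finset.sum_lt_sum (fun j _ => ?_) ⟨i, Finset.mem_univ i, (key i).resolve_right hi⟩
    obtain hj | hj := key j
    · exact hj.le
    · rw [hj, len_negOne]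
      exact Nat.le_add_right _ _
  rw [Finset.sum_add_distrib] at hlt
  exact hlt.ne' h

/-- Elements of equal reflection length are prefix-comparable only if they are equal. -/
theorem eq_of_preLe {ι : Type} [Fintype ι] [DecidableEq ι] {x y}
    (hx : x ∈ piSet ι) (hy : y ∈ piSet ι) (h : preLe (piSet ι) x y)
    (hxy : reflLen (piSet ι) x = reflLen (piSet ι) y) : x = y := by
  obtain ⟨g, hg, rfl⟩ := hx
  obtain ⟨g', hg', rfl⟩ := hy
  rw [reflLen_piLin hg, reflLen_piLin hg'] at hxy
  rw [preLe_piLin hg hg', hxy, Nat.add_eq_left] at h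
  have := totalLen_eq_zero (fun i => (hg i).inv.mul (hg' i)) h
  rw [inv_mul_eq_one.1 this]

end MonoMat

theorem preLe.reflLen_le {V : Type*} [AddCommGroup V] [Module ℂ V] {W : Set (V ≃ₗ[ℂ] V)}
    {u v : V ≃ₗ[ℂ] V} (h : preLe W u v) : reflLen W u ≤ reflLen W v :=
  (Nat.le_add_right _ _).trans_eq h

open MonoMat

/-- The prefix order on `G(10,5,3)¹²` is not Sperner: the union of the largest rank
(rank 37) and a maximal element of rank 36 is an antichain larger than every rank. -/
theorem statement16
    (W : Set ((Fin 12 → Fin 3 → ℂ) ≃ₗ[ℂ] (Fin 12 → Fin 3 → ℂ)))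
    (hW : W = {x | ∃ w : Fin 12 → ((Fin 3 → ℂ) ≃ₗ[ℂ] (Fin 3 → ℂ)),
      (∀ i, w i ∈ Gmpn 10 5 3) ∧ x = LinearEquiv.piCongrRight w}) :
    (∀ i, {x | x ∈ W ∧ reflLen W x = i}.ncard ≤
      {x | x ∈ W ∧ reflLen W x = 37}.ncard) ∧
    (∃ z ∈ W, reflLen W z = 36 ∧ (∀ y ∈ W, preLe W z y → y = z) ∧
      IsAntichainOn W (preLe W) ({x | x ∈ W ∧ reflLen W x = 37} ∪ {z}) ∧
      ∀ i, {x | x ∈ W ∧ reflLen W x = i}.ncard <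
        ({x | x ∈ W ∧ reflLen W x = 37} ∪ {z}).ncard) ∧
    ¬ IsSpernerOn W (preLe W) (reflLen W) := by
  rw [piSet_eq] at hW
  subst hW
  have hzmem : piLin (fun _ : Fin 12 => negOne) ∈ piSet (Fin 12) := piLin_mem fun _ => valid_negOne
  have hzlen : reflLen (piSet (Fin 12)) (piLin fun _ => negOne) = 36 := by
    simp [reflLen_piLin fun _ => valid_negOne, totalLen, len_negOne]
  have hzmax : ∀ y ∈ piSet (Fin 12), preLe (piSet (Fin 12)) (piLin fun _ => negOne) y →
      y = piLin fun _ => negOne := fun _ => eq_negOne_of_preLe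
  generalize piLin (fun _ : Fin 12 => negOne) = z at hzmem hzlen hzmax
  have hanti : IsAntichainOn (piSet (Fin 12)) (preLe (piSet (Fin 12)))
      ({x | x ∈ piSet (Fin 12) ∧ reflLen (piSet (Fin 12)) x = 37} ∪ {z}) := by
    have hnot : ∀ x ∈ ({x | x ∈ piSet (Fin 12) ∧ reflLen (piSet (Fin 12)) x = 37} ∪ {z} : Set _),
        ∀ y ∈ ({x | x ∈ piSet (Fin 12) ∧ reflLen (piSet (Fin 12)) x = 37} ∪ {z} : Set _),
        x ≠ y → ¬ preLe (piSet (Fin 12)) x y := by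
      rintro x (⟨hx, hx37⟩ | rfl) y (⟨hy, hy37⟩ | rfl) hxy hle
      · exact hxy (eq_of_preLe hx hy hle (hx37.trans hy37.symm))
      · have := hle.reflLen_le
        omega
      · exact hxy (hzmax y hy hle).symm
      · exact hxy rfl
    refine ⟨?_, fun x hx y hy hxy => ⟨hnot x hx y hy hxy, hnot y hy x hx hxy.symm⟩⟩
    rintro x (hx | rfl)
    exacts [hx.1, hzmem]
  have hlt : ∀ i, {x | x ∈ piSet (Fin 12) ∧ reflLen (piSet (Fin 12)) x = i}.ncard <
      ({x | x ∈ piSet (Fin 12) ∧ reflLen (piSet (Fin 12)) x = 37} ∪ {z}).ncard := by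
    intro i
    have hz : z ∉ {x | x ∈ piSet (Fin 12) ∧ reflLen (piSet (Fin 12)) x = 37} := by
      rintro ⟨-, h⟩
      omega
    rw [Set.union_singleton, Set.ncard_insert_of_notMem hz
      ((finite_piSet (Fin 12)).subset fun _ hx => hx.1)]
    exact Nat.lt_succ_of_le (ncard_rank_le i)
  refine ⟨ncard_rank_le, ⟨z, hzmem, hzlen, hzmax, hanti, hlt⟩, fun h => ?_⟩
  obtain ⟨i, hi⟩ := h _ hanti
  exact (hlt i).not_ge hi

end
end
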